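/- arXiv:2507.18025 — 5 statements merged into one kernel-verified Lean document; each statement's English description precedes it below -/
import Mathlib

section
/- Let K ≥ 2 and N ≥ 1 be integers, let Z_1,…,Z_K ⊆ {1,…,N}, and set r_k = |Z_k|, d_k = N + (K−1)r_k − Σ_{k'=1}^{K} r_{k'}, S = Σ_{k=1}^{K} d_k, and P_k = ⋃_{i=0}^{K−2} {n + iN : n ∈ {1,…,N}∖Z_k} ⊆ {1,…,(K−1)N}. Assume d_k ≥ 1 for every k and Condition 1 (subset form): for every nonempty subset T ⊆ {1,…,K}, |⋂_{i∈T} P_i| ≤ S − Σ_{i∈T} d_i. Let q be a prime power with q ≥ S + (K−1)N and let E be a positive multiple of K−1. Then there exists a correct (K,N;{Z_k}) DMTL scheme over F_q with parameter E whose message lengths satisfy T_k = d_k·E/(K−1) for every k ∈ {1,…,K} and T = (N − min_{k∈{1,…,K}} r_k)·E; in particular its uplink load equals (Σ_k T_k)/E = S/(K−1) and its downlink load equals T/E = N − min_k r_k. -/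
/-- A `(K, N; {Z_k})` DMTL scheme over a field `F` with parameter `E` and message
lengths `Tk 0, …, Tk (K-1), T`: uplink encoders `enc k` mapping the restriction of
the local update values to `Z k` to a message of length `Tk k`, a server encoder
`srv`, and decoders `dec k` using the broadcast message and the side information. -/
structure DMTLScheme (F : Type*) [Field F] (K N E : ℕ)
    (Z : Fin K → Finset (Fin N)) (Tk : Fin K → ℕ) (T : ℕ) where
  enc : ∀ k : Fin K, (({n : Fin N // n ∈ Z k}) → Fin E → F) → Fin (Tk k) → F
  srv : (∀ k : Fin K, Fin (Tk k) → F) → Fin T → F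
  dec : ∀ k : Fin K, (Fin T → F) → (({n : Fin N // n ∈ Z k}) → Fin E → F) →
    (Fin N → Fin E → F)

/-- Correctness: every worker `k` recovers the full tuple `v = (v_1, …, v_N)` from the
broadcast message and its side information `v|_{Z_k}`. -/
def DMTLScheme.Correct {F : Type*} [Field F] {K N E : ℕ}
    {Z : Fin K → Finset (Fin N)} {Tk : Fin K → ℕ} {T : ℕ}
    (sch : DMTLScheme F K N E Z Tk T) : Prop :=
  ∀ (v : Fin N → Fin E → F) (k : Fin K),
    sch.dec k (sch.srv (fun j => sch.enc j (fun n => v n.1))) (fun n => v n.1) = v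

/-- An affine function of one variable that is not identically zero has at most one zero. -/
theorem card_filter_affine_eq_zero_le_one {F : Type*} [Field F] [Fintype F] [DecidableEq F]
    {g : F → F} {a b : F} (hg : ∀ t, g t = a + b * t) {t₀ : F} (h₀ : g t₀ ≠ 0) :
    (Finset.univ.filter (fun t => g t = 0)).card ≤ 1 := by
  rw [Finset.card_le_one]
  intro t ht t' ht'
  simp only [Finset.mem_filter, Finset.mem_univ, true_and, hg] at ht ht'
  rw [hg] at h₀
  by_contra hne
  have hb : b * (t - t') = 0 := by linear_combination ht - ht'
  rcases mul_eq_zero.mp hb with hb | hb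
  · subst hb
    simp at ht
    simp [ht] at h₀
  · exact hne (sub_eq_zero.mp hb)

/-- Finitely many functions, none identically zero and each affine in every variable,
have a common nonvanishing point over a field with more elements than there are functions. -/
theorem exists_common_ne_zero_of_multiaffine {F I W : Type*} [Field F] [Fintype F]
    [Fintype I] [DecidableEq I] [DecidableEq W] (f : W → (I → F) → F)
    (hf : ∀ w x i, ∃ a b, ∀ t, f w (Function.update x i t) = a + b * t)
    (hne : ∀ w, ∃ x, f w x ≠ 0) (s : Finset W) (hs : s.card < Fintype.card F) :
    ∃ x, ∀ w ∈ s, f w x ≠ 0 := by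
  classical
  induction s using Finset.induction_on with
  | empty => exact ⟨0, by simp⟩
  | insert w₀ s hw₀ ih =>
    rw [Finset.card_insert_of_notMem hw₀] at hs
    obtain ⟨x, hx⟩ := ih (by omega)
    obtain ⟨y, hy⟩ := hne w₀
    obtain ⟨n, hn⟩ : ∃ n, hammingDist x y = n := ⟨_, rfl⟩
    induction n using Nat.strong_induction_on generalizing x y with
    | _ n IH =>
    by_cases hxy : x = y
    · subst hxy
      exact ⟨x, by simpa [hy] using hx⟩
    · obtain ⟨i, hi⟩ := Function.ne_iff.mp hxy
      let bad (w : W) (z : I → F) : Finset F :=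
        Finset.univ.filter (fun t => f w (Function.update z i t) = 0)
      have hbad : ∀ w z, f w z ≠ 0 → (bad w z).card ≤ 1 := by
        intro w z hz
        obtain ⟨a, b, hab⟩ := hf w z i
        exact card_filter_affine_eq_zero_le_one hab (t₀ := z i) (by simpa using hz)
      have hcard : (s.biUnion (fun w => bad w x) ∪ bad w₀ y).card < Fintype.card F := by
        have h1 := Finset.card_biUnion_le_card_mul s (fun w => bad w x) 1
          (fun w hw => hbad w x (hx w hw))
        have h2 := hbad w₀ y hy
        have h3 := Finset.card_union_le (s.biUnion (fun w => bad w x)) (bad w₀ y)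
        omega
      obtain ⟨t, ht⟩ : ∃ t, t ∉ s.biUnion (fun w => bad w x) ∪ bad w₀ y := by
        by_contra! hall
        rw [Finset.eq_univ_of_forall hall, Finset.card_univ] at hcard
        exact lt_irrefl _ hcard
      simp only [bad, Finset.mem_union, Finset.mem_biUnion, Finset.mem_filter, Finset.mem_univ,
        true_and, not_or, not_exists, not_and] at ht
      refine IH _ ?_ (Function.update x i t) ht.1 (Function.update y i t) ht.2 rfl
      rw [← hn]
      refine Finset.card_lt_card (Finset.ssubset_iff.mpr ⟨i, by simp, ?_⟩)
      intro j hj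
      rcases Finset.mem_insert.mp hj with rfl | hj
      · simpa using hi
      · by_cases hji : j = i
        · subst hji
          simpa using hi
        · simpa [Function.update_of_ne hji] using hj

/-- The determinant of a matrix is affine in each of its entries. -/
theorem Matrix.exists_det_updateRow_update_eq {F n : Type*} [Field F] [Fintype n] [DecidableEq n]
    (M : Matrix n n F) (i j : n) :
    ∃ a b, ∀ t, (M.updateRow i (Function.update (M i) j t)).det = a + b * t := by
  refine ⟨(M.updateRow i (Function.update (M i) j 0)).det,
    (M.updateRow i (Pi.single j 1)).det, fun t => ?_⟩
  have h : Function.update (M i) j t = Function.update (M i) j 0 + t • Pi.single j (1 : F) := by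
    ext c
    by_cases hc : c = j
    · subst hc; simp
    · simp [hc]
  rw [h, Matrix.det_updateRow_add, Matrix.det_updateRow_smul, mul_comm]

/-- If for each `k` the rows not owned by `k` are matched bijectively with the columns `P k`
inside the allowed support, then some matrix with that support is injective on vectors
supported on `P k`, for all `k` simultaneously. -/
theorem exists_supported_matrix_injective {F R C W : Type*} [Field F] [Fintype F] [Fintype R]
    [Fintype C] [Fintype W] [DecidableEq R] [DecidableEq C] [DecidableEq W]
    (w : R → W) (P : W → Finset C) (hF : Fintype.card W < Fintype.card F)
    (e : ∀ k, {ρ // w ρ ≠ k} ≃ {c // c ∈ P k})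
    (he : ∀ k (ρ : {ρ // w ρ ≠ k}), (e k ρ : C) ∉ P (w ρ)) :
    ∃ A : R → C → F, (∀ ρ, ∀ c ∈ P (w ρ), A ρ c = 0) ∧
      ∀ k (u : C → F), (∀ c, c ∉ P k → u c = 0) →
        (∀ ρ, ∑ c, A ρ c * u c = 0) → u = 0 := by
  classical
  let ent (x : R × C → F) (ρ : R) (c : C) : F := if c ∈ P (w ρ) then 0 else x (ρ, c)
  let B (k : W) (x : R × C → F) : Matrix {ρ // w ρ ≠ k} {ρ // w ρ ≠ k} F :=
    Matrix.of fun ρ σ => ent x ρ (e k σ)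
  have haff : ∀ k x p, ∃ a b, ∀ t, (B k (Function.update x p t)).det = a + b * t := by
    rintro k x ⟨ρ, c⟩
    by_cases hdep : ∃ (hρ : w ρ ≠ k) (hc : c ∈ P k), c ∉ P (w ρ)
    · obtain ⟨hρ, hc, hsup⟩ := hdep
      obtain ⟨a, b, hab⟩ := Matrix.exists_det_updateRow_update_eq (B k x) ⟨ρ, hρ⟩
        ((e k).symm ⟨c, hc⟩)
      refine ⟨a, b, fun t => ?_⟩
      rw [← hab]
      congr 1
      ext σ τ
      by_cases hσ : σ = ⟨ρ, hρ⟩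
      · subst hσ
        by_cases hτ : τ = (e k).symm ⟨c, hc⟩
        · subst hτ
          simp [B, ent, hsup]
        · have : (e k τ : C) ≠ c := by
            intro h
            exact hτ ((e k).eq_symm_apply.mpr (Subtype.ext h))
          simp [B, ent, hτ, this]
      · have : (σ : R) ≠ ρ := fun h => hσ (Subtype.ext h)
        simp [B, ent, Matrix.updateRow_ne hσ, this]
    · refine ⟨(B k x).det, 0, fun t => ?_⟩
      rw [zero_mul, add_zero]
      congr 1
      ext σ τ
      simp only [B, ent, Matrix.of_apply]
      split_ifs with h
      · rfl
      · refine Function.update_of_ne ?_ _ _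
        intro heq
        obtain ⟨h1, h2⟩ := Prod.mk.inj heq
        subst h1 h2
        exact hdep ⟨σ.2, (e k τ).2, h⟩
  have hne : ∀ k, ∃ x, (B k x).det ≠ 0 := by
    intro k
    refine ⟨fun p => if h : w p.1 ≠ k then (if p.2 = e k ⟨p.1, h⟩ then 1 else 0) else 0, ?_⟩
    have : B k (fun p => if h : w p.1 ≠ k then (if p.2 = e k ⟨p.1, h⟩ then 1 else 0) else 0)
        = 1 := by
      ext σ τ
      have hσ := σ.2
      by_cases hστ : σ = τ
      · subst hστ
        simp [B, ent, he, hσ]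
      · have : (e k τ : C) ≠ e k σ := by
          intro h
          exact hστ ((e k).injective (Subtype.ext h)).symm
        simp [B, ent, Matrix.one_apply_ne hστ, this]
    rw [this]
    simp
  obtain ⟨x, hx⟩ := exists_common_ne_zero_of_multiaffine (fun k x => (B k x).det) haff hne
    Finset.univ hF
  refine ⟨ent x, fun ρ c hc => if_pos hc, fun k u hu hsum => ?_⟩
  have hv : (B k x).mulVec (fun σ => u (e k σ)) = 0 := by
    ext ρ
    have h := hsum ρ
    rw [← Finset.sum_subset (Finset.subset_univ (P k))
      (fun c _ hc => by rw [hu c hc, mul_zero]), ← Finset.sum_coe_sort,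
      ← (e k).sum_comp] at h
    simpa [Matrix.mulVec, dotProduct, B] using h
  have h0 := Matrix.eq_zero_of_mulVec_eq_zero (hx k (Finset.mem_univ k)) hv
  ext c
  by_cases hc : c ∈ P k
  · simpa using congrFun h0 ((e k).symm ⟨c, hc⟩)
  · exact hu c hc

/-- A vector with at most `D` nonzero coordinates whose first `D` power moments at distinct
nodes vanish is zero. -/
theorem eq_zero_of_sum_pow_mul_eq_zero {F R : Type*} [Field F] [Fintype R] [DecidableEq R]
    {g : R → F} (hg : Function.Injective g) {D : ℕ} {s : Finset R} (hs : s.card ≤ D)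
    {y : R → F} (hy : ∀ ρ, ρ ∉ s → y ρ = 0)
    (h : ∀ i : Fin D, ∑ ρ, g ρ ^ (i : ℕ) * y ρ = 0) : y = 0 := by
  ext ρ₀
  by_cases hρ₀ : ρ₀ ∈ s
  swap
  · exact hy ρ₀ hρ₀
  let p : Polynomial F := ∏ σ ∈ s.erase ρ₀, (Polynomial.X - Polynomial.C (g σ))
  have hdeg : p.natDegree < D := by
    have h1 := Finset.card_erase_lt_of_mem hρ₀
    simp only [p, Polynomial.natDegree_finsetProd_X_sub_C_eq_card]
    omega
  have hsum : ∑ ρ, p.eval (g ρ) * y ρ = 0 := by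
    simp only [Polynomial.eval_eq_sum_range' hdeg, Finset.sum_mul]
    rw [Finset.sum_comm]
    refine Finset.sum_eq_zero fun i hi => ?_
    have := h ⟨i, Finset.mem_range.mp hi⟩
    simp only [mul_assoc, ← Finset.mul_sum]
    rw [this, mul_zero]
  rw [Finset.sum_eq_single ρ₀] at hsum
  · refine (mul_eq_zero.mp hsum).resolve_left ?_
    simp only [p, Polynomial.eval_prod, Finset.prod_ne_zero_iff]
    intro σ hσ
    simpa [sub_eq_zero] using fun h' => (Finset.ne_of_mem_erase hσ) (hg h').symm
  · intro ρ _ hρ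
    by_cases hρs : ρ ∈ s
    · have : p.eval (g ρ) = 0 := by
        simp only [p, Polynomial.eval_prod]
        exact Finset.prod_eq_zero (Finset.mem_erase.mpr ⟨hρ, hρs⟩) (by simp)
      rw [this, zero_mul]
    · rw [hy ρ hρs, mul_zero]
  · simp

/-- Encoders admit correct decoders as soon as the broadcast message together with the side
information of each worker determines the data. -/
theorem DMTLScheme.exists_correct {F : Type*} [Field F] {K N E : ℕ}
    {Z : Fin K → Finset (Fin N)} {Tk : Fin K → ℕ} {T : ℕ}
    (enc : ∀ k : Fin K, (({n : Fin N // n ∈ Z k}) → Fin E → F) → Fin (Tk k) → F)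
    (srv : (∀ k : Fin K, Fin (Tk k) → F) → Fin T → F)
    (h : ∀ (k : Fin K) (v v' : Fin N → Fin E → F), (∀ n ∈ Z k, v n = v' n) →
      srv (fun j => enc j (fun n => v n.1)) = srv (fun j => enc j (fun n => v' n.1)) → v = v') :
    ∃ sch : DMTLScheme F K N E Z Tk T, sch.Correct := by
  classical
  have hinj : ∀ k : Fin K, Function.Injective (fun v : Fin N → Fin E → F =>
      ((srv (fun j => enc j (fun n => v n.1)), fun n => v n.1) :
        (Fin T → F) × ({n : Fin N // n ∈ Z k} → Fin E → F))) := by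
    intro k v v' hv
    obtain ⟨h1, h2⟩ := Prod.mk.inj hv
    exact h k v v' (fun n hn => congrFun h2 ⟨n, hn⟩) h1
  exact ⟨⟨enc, srv, fun k t u => Function.invFun (fun v : Fin N → Fin E → F =>
      ((srv (fun j => enc j (fun n => v n.1)), fun n => v n.1) :
        (Fin T → F) × ({n : Fin N // n ∈ Z k} → Fin E → F))) (t, u)⟩,
    fun v k => Function.leftInverse_invFun (hinj k) v⟩

/-- Membership in a finite nonempty infimum of finsets is membership in all of them. -/
theorem Finset.mem_inf'_iff {W C : Type*} [DecidableEq C] {T : Finset W} (hT : T.Nonempty)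
    {P : W → Finset C} {c : C} : c ∈ T.inf' hT P ↔ ∀ k ∈ T, c ∈ P k := by
  simpa only [← Finset.singleton_subset_iff] using
    Finset.le_inf'_iff hT P (a := ({c} : Finset C))

/-- Hall's theorem for rows grouped into blocks of sizes `d j`, all rows of block `j` being
adjacent to the columns outside `P j`. -/
theorem exists_equiv_block_rows {W C : Type*} [Fintype W] [DecidableEq W] [DecidableEq C]
    (d : W → ℕ) (P : W → Finset C)
    (hcard : ∀ k, (P k).card + d k = ∑ j, d j)
    (hcond : ∀ (T : Finset W) (hT : T.Nonempty), (T.inf' hT P).card + ∑ j ∈ T, d j ≤ ∑ j, d j)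
    (k : W) :
    ∃ e : {ρ : Σ j, Fin (d j) // ρ.1 ≠ k} ≃ {c // c ∈ P k},
      ∀ ρ, (e ρ : C) ∉ P ρ.1.1 := by
  classical
  have hall := (Finset.all_card_le_biUnion_card_iff_exists_injective
    (fun ρ : {ρ : Σ j, Fin (d j) // ρ.1 ≠ k} => P k \ P ρ.1.1)).mp ?_
  · obtain ⟨f, hf, hfm⟩ := hall
    simp only [Finset.mem_sdiff] at hfm
    let f' : {ρ : Σ j, Fin (d j) // ρ.1 ≠ k} → {c // c ∈ P k} := fun ρ => ⟨f ρ, (hfm ρ).1⟩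
    have hf' : Function.Injective f' := fun a b hab => hf (congrArg Subtype.val hab)
    have hbij : Function.Bijective f' := by
      rw [Fintype.bijective_iff_injective_and_card]
      refine ⟨hf', ?_⟩
      rw [Fintype.card_coe]
      have h1 : Fintype.card {ρ : Σ j, Fin (d j) // ρ.1 = k} = d k := by
        rw [Fintype.card_congr (Equiv.sigmaSubtype k), Fintype.card_fin]
      have h2 := Fintype.card_subtype_compl (fun ρ : Σ j, Fin (d j) => ρ.1 = k)
      rw [h1, Fintype.card_sigma] at h2
      simp only [Fintype.card_fin] at h2
      have h3 := hcard k
      simp only [ne_eq]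
      omega
    exact ⟨Equiv.ofBijective f' hbij, fun ρ => (hfm ρ).2⟩
  · intro s
    rcases s.eq_empty_or_nonempty with rfl | hs
    · simp
    let J : Finset W := s.image (fun ρ => ρ.1.1)
    have hJ : J.Nonempty := hs.image _
    have hkJ : k ∉ J := by
      simp only [J, Finset.mem_image, not_exists, not_and]
      exact fun ρ _ => ρ.2
    have hsJ : s.card ≤ ∑ j ∈ J, d j := by
      have : s.card ≤ (J.sigma (fun j => (Finset.univ : Finset (Fin (d j))))).card := by
        refine Finset.card_le_card_of_injOn (fun ρ => ρ.1) ?_ Subtype.val_injective.injOn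
        intro ρ hρ
        simp only [Finset.coe_sigma, Set.mem_sigma_iff, Finset.coe_univ, Set.mem_univ, and_true]
        exact Finset.mem_coe.mpr (Finset.mem_image_of_mem _ hρ)
      simpa using this
    have hsub : P k \ (insert k J).inf' (Finset.insert_nonempty k J) P ⊆
        s.biUnion (fun ρ => P k \ P ρ.1.1) := by
      intro c hc
      rw [Finset.mem_sdiff, Finset.mem_inf'_iff] at hc
      obtain ⟨hck, hc⟩ := hc
      push Not at hc
      obtain ⟨j, hj, hcj⟩ := hc
      rcases Finset.mem_insert.mp hj with rfl | hj
      · exact absurd hck hcj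
      · obtain ⟨ρ, hρ, rfl⟩ := Finset.mem_image.mp hj
        exact Finset.mem_biUnion.mpr ⟨ρ, hρ, Finset.mem_sdiff.mpr ⟨hck, hcj⟩⟩
    have h1 := Finset.card_le_card hsub
    have h2 := Finset.le_card_sdiff ((insert k J).inf' (Finset.insert_nonempty k J) P) (P k)
    have h3 := hcond _ (Finset.insert_nonempty k J)
    rw [Finset.sum_insert hkJ] at h3
    have h4 := hcard k
    omega

/-- Existence of a scheme from a family of block sizes `d` and `m`-fold subpacketization. -/
theorem DMTLScheme.exists_correct_of_card {F : Type*} [Field F] [Fintype F] {K N m L D : ℕ}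
    (Z : Fin K → Finset (Fin N)) (d : Fin K → ℕ)
    (hK : K < Fintype.card F) (hd : ∑ j, d j ≤ Fintype.card F)
    (hcard : ∀ k, ((Z k)ᶜ ×ˢ (Finset.univ : Finset (Fin m))).card + d k = ∑ j, d j)
    (hD : ∀ k, ((Z k)ᶜ ×ˢ (Finset.univ : Finset (Fin m))).card ≤ D)
    (hcond : ∀ (T : Finset (Fin K)) (hT : T.Nonempty),
      (T.inf' hT (fun k => (Z k)ᶜ ×ˢ (Finset.univ : Finset (Fin m)))).card + ∑ j ∈ T, d j
        ≤ ∑ j, d j) :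
    ∃ sch : DMTLScheme F K N (m * L) Z (fun k => d k * L) (D * L), sch.Correct := by
  classical
  let P (k : Fin K) : Finset (Fin N × Fin m) := (Z k)ᶜ ×ˢ Finset.univ
  have hP : ∀ k c, c ∈ P k ↔ c.1 ∉ Z k := fun k c => by simp [P]
  choose e he using exists_equiv_block_rows d P hcard hcond
  obtain ⟨A, hA, hinj⟩ := exists_supported_matrix_injective (F := F)
    (fun ρ : Σ j, Fin (d j) => ρ.1) P (by simpa using hK) e he
  obtain ⟨⟨g, hg⟩⟩ : Nonempty ((Σ j, Fin (d j)) ↪ F) :=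
    Function.Embedding.nonempty_of_card_le (by simpa using hd)
  refine DMTLScheme.exists_correct
    (fun k x t => ∑ c : Fin N × Fin m, A ⟨k, (finProdFinEquiv.symm t).1⟩ c *
      (if h : c.1 ∈ Z k then
        x ⟨c.1, h⟩ (finProdFinEquiv (c.2, (finProdFinEquiv.symm t).2)) else 0))
    (fun x t => ∑ ρ : Σ j, Fin (d j), g ρ ^ ((finProdFinEquiv.symm t).1 : ℕ) *
      x ρ.1 (finProdFinEquiv (ρ.2, (finProdFinEquiv.symm t).2))) ?_
  intro k v v' hvv' heq
  have henc : ∀ (z : Fin N → Fin (m * L) → F) (l : Fin L) (ρ : Σ j, Fin (d j)),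
      (∑ c : Fin N × Fin m, A ρ c *
        (if c.1 ∈ Z ρ.1 then z c.1 (finProdFinEquiv (c.2, l)) else 0)) =
      ∑ c : Fin N × Fin m, A ρ c * z c.1 (finProdFinEquiv (c.2, l)) := by
    intro z l ρ
    refine Finset.sum_congr rfl fun c _ => ?_
    split_ifs with h
    · rfl
    · rw [hA ρ c ((hP _ c).mpr h), zero_mul, zero_mul]
  have hu : ∀ l : Fin L, (fun c : Fin N × Fin m =>
      v c.1 (finProdFinEquiv (c.2, l)) - v' c.1 (finProdFinEquiv (c.2, l))) = 0 := by
    intro l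
    have hsupp : ∀ c : Fin N × Fin m, c ∉ P k →
        v c.1 (finProdFinEquiv (c.2, l)) - v' c.1 (finProdFinEquiv (c.2, l)) = 0 := by
      intro c hc
      rw [hP, not_not] at hc
      rw [hvv' _ hc, sub_self]
    refine hinj k _ hsupp (congrFun (f := fun ρ => ∑ c, A ρ c * _) (g := 0) ?_)
    refine eq_zero_of_sum_pow_mul_eq_zero hg (D := D)
      (s := Finset.univ.filter (fun ρ : Σ j, Fin (d j) => ρ.1 ≠ k)) ?_ ?_ ?_
    · rw [← Fintype.card_subtype, Fintype.card_congr (e k), Fintype.card_coe]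
      exact hD k
    · intro ρ hρ
      simp only [Finset.mem_filter, Finset.mem_univ, true_and, not_not] at hρ
      refine Finset.sum_eq_zero fun c _ => ?_
      by_cases hc : c ∈ P k
      · rw [hA ρ c (by rw [hρ]; exact hc), zero_mul]
      · rw [hsupp c hc, mul_zero]
    · intro i
      have h := congrFun heq (finProdFinEquiv (i, l))
      simp only [Equiv.symm_apply_apply, dite_eq_ite, henc] at h
      simp only [mul_sub, Finset.sum_sub_distrib]
      exact sub_eq_zero.mpr h
  ext n t
  obtain ⟨⟨i, l⟩, rfl⟩ := finProdFinEquiv.surjective t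
  exact sub_eq_zero.mp (congrFun (hu l) (n, i))

/-- achievability.  With `r_k = |Z_k|`,
`d_k = N + (K−1)r_k − Σ_{k'} r_{k'}`, `S = Σ_k d_k`, and
`P_k = ⋃_{i=0}^{K−2} {n + iN : n ∈ {1,…,N}∖Z_k} ⊆ {1,…,(K−1)N}` (data indices are
modelled by `Fin N`, with `n : Fin N` corresponding to the `1`-based index `n + 1`),
assume `d_k ≥ 1` for every `k` and Condition 1 (subset form):
`|⋂_{i∈T} P_i| ≤ S − Σ_{i∈T} d_i` for every nonempty `T ⊆ {1,…,K}`.  Let `q` be a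
prime power with `q ≥ S + (K−1)N` and let `E` be a positive multiple of `K−1`.  Then
over the field with `q` elements there is a correct `(K, N; {Z_k})` DMTL scheme with
parameter `E` whose message lengths satisfy `T_k = d_k·E/(K−1)`
(i.e. `T_k·(K−1) = d_k·E`) for every `k`, and `T = (N − min_k r_k)·E`. -/
theorem optimal_scheme_exists (K N : ℕ) (hK : 2 ≤ K) (hN : 1 ≤ N)
    (Z : Fin K → Finset (Fin N))
    (r : Fin K → ℕ) (hr : ∀ k, r k = (Z k).card)
    (d : Fin K → ℤ) (hd : ∀ k, d k = (N : ℤ) + ((K : ℤ) - 1) * r k - ∑ k', (r k' : ℤ))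
    (S : ℤ) (hS : S = ∑ k, d k)
    (P : Fin K → Finset ℕ)
    (hP : ∀ k, P k = (Finset.range (K - 1)).biUnion
      (fun i => ((Z k)ᶜ).image (fun n : Fin N => (n : ℕ) + 1 + i * N)))
    (hdpos : ∀ k, 1 ≤ d k)
    (hcond : ∀ (T : Finset (Fin K)) (hT : T.Nonempty),
      ((T.inf' hT P).card : ℤ) ≤ S - ∑ i ∈ T, d i)
    (q : ℕ) (hq : IsPrimePow q) (hqge : S + ((K : ℤ) - 1) * N ≤ (q : ℤ))
    (E : ℕ) (hE : 0 < E) (hEdvd : (K - 1) ∣ E)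
    (F : Type) [Field F] [Fintype F] (hF : Fintype.card F = q) :
    ∃ (Tk : Fin K → ℕ) (T : ℕ) (sch : DMTLScheme F K N E Z Tk T),
      sch.Correct ∧
      (∀ k, (Tk k : ℤ) * ((K : ℤ) - 1) = d k * E) ∧
      T = (N - Finset.univ.inf' ⟨(⟨0, by omega⟩ : Fin K), Finset.mem_univ _⟩
            (fun k => (Z k).card)) * E := by
  obtain ⟨m, rfl⟩ : ∃ m, K = m + 1 := ⟨K - 1, by omega⟩
  simp only [Nat.add_sub_cancel] at hEdvd hP
  obtain ⟨L, rfl⟩ := hEdvd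
  obtain rfl : r = fun k => (Z k).card := funext hr
  lift d to Fin (m + 1) → ℕ using fun k => by linarith [hdpos k]
  simp only [Nat.cast_add, Nat.cast_one, add_sub_cancel_right] at hd hqge ⊢
  have hrN : ∀ k, (Z k).card ≤ N := fun k => by simpa using Finset.card_le_univ (Z k)
  have hSN : S = ((∑ j, d j : ℕ) : ℤ) := by rw [hS]; push_cast; rfl
  have hcompl : ∀ k, ((Z k)ᶜ ×ˢ (Finset.univ : Finset (Fin m))).card = (N - (Z k).card) * m := by
    intro k
    simp [Finset.card_compl]
  have hSm : ∀ k, ((N - (Z k).card) * m : ℤ) + d k = S := by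
    intro k
    rw [hS, Finset.sum_congr rfl (fun j _ => hd j), hd k]
    simp only [Finset.sum_sub_distrib, Finset.sum_add_distrib, ← Finset.mul_sum,
      Finset.sum_const, Finset.card_univ, Fintype.card_fin, nsmul_eq_mul]
    push_cast
    ring
  have hmin : ∀ k, Finset.univ.inf' ⟨(⟨0, by omega⟩ : Fin (m + 1)), Finset.mem_univ _⟩
      (fun k => (Z k).card) ≤ (Z k).card := fun k => Finset.inf'_le _ (Finset.mem_univ k)
  have hmN : m ≤ m * N := Nat.le_mul_of_pos_right m hN
  have hdsum : m + 1 ≤ ∑ j, d j := by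
    have h : ∑ _j : Fin (m + 1), 1 ≤ ∑ j, d j :=
      Finset.sum_le_sum fun j _ => by have h := hdpos j; dsimp only at h; exact_mod_cast h
    simpa using h
  have hqge' : (∑ j, d j) + m * N ≤ Fintype.card F := by
    rw [hF]
    rw [hSN] at hqge
    exact_mod_cast hqge
  suffices h : ∃ sch : DMTLScheme F (m + 1) N (m * L) Z (fun k => d k * L)
      ((N - Finset.univ.inf' ⟨(⟨0, by omega⟩ : Fin (m + 1)), Finset.mem_univ _⟩
        (fun k => (Z k).card)) * m * L), sch.Correct by
    obtain ⟨sch, hsch⟩ := h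
    refine ⟨_, _, sch, hsch, fun k => ?_, by ring⟩
    push_cast
    ring
  refine DMTLScheme.exists_correct_of_card Z d (by omega) (by omega) ?_ ?_ ?_
  · intro k
    rw [hcompl]
    zify [hrN k]
    have h := hSm k
    rw [hS] at h
    exact h
  · intro k
    rw [hcompl]
    exact Nat.mul_le_mul_right m (Nat.sub_le_sub_left (hmin k) N)
  · intro T hT
    have h := hcond T hT
    suffices hle : (T.inf' hT (fun k => (Z k)ᶜ ×ˢ (Finset.univ : Finset (Fin m)))).card ≤
        (T.inf' hT P).card by
      rw [hS] at h
      zify at hle ⊢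
      linarith
    refine Finset.card_le_card_of_injOn (fun c => (c.1 : ℕ) + 1 + c.2 * N) ?_ ?_
    · intro c hc
      rw [Finset.mem_coe, Finset.mem_inf'_iff]
      intro k hk
      rw [hP k]
      simp only [Finset.mem_biUnion, Finset.mem_image, Finset.mem_range]
      exact ⟨c.2, c.2.2, c.1, (Finset.mem_product.mp ((Finset.mem_inf'_iff hT).mp hc k hk)).1, rfl⟩
    · rintro ⟨a, i⟩ _ ⟨b, j⟩ _ h
      have h' : (a : ℕ) + i * N = b + j * N := by
        simp only at h
        omega
      have hab : (a : ℕ) = b := by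
        have := congrArg (· % N) h'
        simpa [Nat.mod_eq_of_lt a.2, Nat.mod_eq_of_lt b.2] using this
      have hij : (i : ℕ) = j := by
        rw [hab] at h'
        exact Nat.eq_of_mul_eq_mul_right hN (Nat.add_left_cancel h')
      exact Prod.ext (Fin.ext hab) (Fin.ext hij)
end

section
/- Let K ≥ 2 be an integer, N = K, and Z_1,…,Z_K ⊆ {1,…,N}; for z ∈ {1,…,K} let I_z = {n ∈ {1,…,N} : |{k : n ∈ Z_k}| = z}. Then every correct (K,N;{Z_k}) DMTL scheme over F_q with parameter E and message lengths T_1,…,T_K,T satisfies (K−1)·Σ_{k=1}^{K} T_k ≥ E·(K·N − Σ_{z=1}^{K} z·|I_z|), i.e., the uplink load is at least KN/(K−1) − Σ_{z=1}^{K} z|I_z|/(K−1). -/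
/-- If worker `k` decodes correctly, the messages of the other workers carry all the update
values missing from `Z k`. -/
theorem DMTLScheme.Correct.mul_card_compl_le {F : Type*} [Field F] [Fintype F] {K N E : ℕ}
    {Z : Fin K → Finset (Fin N)} {Tk : Fin K → ℕ} {T : ℕ}
    {sch : DMTLScheme F K N E Z Tk T} (hc : sch.Correct) (k : Fin K) :
    E * (Z k)ᶜ.card ≤ ∑ j ∈ Finset.univ.erase k, Tk j := by
  classical
  let ext (w : {n : Fin N // n ∈ (Z k)ᶜ} → Fin E → F) : Fin N → Fin E → F :=
    fun n => if h : n ∈ (Z k)ᶜ then w ⟨n, h⟩ else 0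
  let msg (w : {n : Fin N // n ∈ (Z k)ᶜ} → Fin E → F)
      (j : {j : Fin K // j ∈ Finset.univ.erase k}) : Fin (Tk j) → F :=
    sch.enc j (fun n => ext w n.1)
  have hside (w w' : {n : Fin N // n ∈ (Z k)ᶜ} → Fin E → F) :
      (fun n : {n : Fin N // n ∈ Z k} => ext w n.1) = fun n => ext w' n.1 := by
    funext n
    simp [ext, n.2]
  have hmsg : Function.Injective msg := by
    intro w w' h
    have hall : (fun j => sch.enc j (fun n => ext w n.1)) =
        fun j => sch.enc j (fun n => ext w' n.1) := by
      funext j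
      by_cases hj : j = k
      · subst hj
        rw [hside w w']
      · exact congrFun h ⟨j, by simp [hj]⟩
    have hext : ext w = ext w' := by
      rw [← hc (ext w) k, ← hc (ext w') k, hall, hside w w']
    funext n
    simpa only [ext, n.2, dif_pos] using congrFun hext n.1
  have hcard := Fintype.card_le_of_injective msg hmsg
  simp only [Fintype.card_fun, Fintype.card_pi, Fintype.card_fin, Fintype.card_coe,
    Finset.prod_pow_eq_pow_sum, ← pow_mul] at hcard
  rw [Finset.univ_eq_attach, Finset.sum_attach (Finset.univ.erase k) Tk] at hcard
  exact (Nat.pow_le_pow_iff_right Fintype.one_lt_card).1 hcard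

/-- Double counting of the incidences `a ∈ Z k`, grouped by the multiplicity of `a`. -/
theorem sum_mul_card_filter_multiplicity_eq_sum_card {ι α : Type*} [Fintype ι] [Fintype α]
    [DecidableEq α] (Z : ι → Finset α) :
    ∑ z ∈ Finset.Icc 1 (Fintype.card ι), z * (Finset.univ.filter
        (fun a : α => (Finset.univ.filter (fun k => a ∈ Z k)).card = z)).card
      = ∑ k, (Z k).card := by
  have hdouble : ∑ a : α, (Finset.univ.filter (fun k => a ∈ Z k)).card = ∑ k, (Z k).card := by
    simp only [Finset.card_eq_sum_ones, Finset.sum_filter]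
    rw [Finset.sum_comm]
    simp
  have hfiber := Finset.sum_fiberwise_of_maps_to
    (s := Finset.univ) (t := Finset.range (Fintype.card ι + 1))
    (g := fun a : α => (Finset.univ.filter (fun k => a ∈ Z k)).card)
    (fun a _ => Finset.mem_range_succ_iff.2 (Finset.card_le_univ _))
    (fun a => (Finset.univ.filter (fun k => a ∈ Z k)).card)
  rw [← hdouble, ← hfiber]
  have hsub : Finset.Icc 1 (Fintype.card ι) ⊆ Finset.range (Fintype.card ι + 1) := by
    intro z hz
    simp at hz ⊢
    omega
  rw [← Finset.sum_subset hsub]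
  · refine Finset.sum_congr rfl fun z _ => ?_
    rw [Finset.sum_congr rfl fun a ha => (Finset.mem_filter.1 ha).2, Finset.sum_const,
      smul_eq_mul, mul_comm]
  · intro z hz hz'
    obtain rfl : z = 0 := by
      simp at hz hz'
      omega
    exact Finset.sum_eq_zero fun a ha => (Finset.mem_filter.1 ha).2

/-- converse bound on the uplink communication load when `N = K`:
`(K−1)·Σ_k T_k ≥ E·(K·N − Σ_{z=1}^{K} z·|I_z|)`. -/
theorem uplink_converse (K : ℕ) (hK : 2 ≤ K) (N : ℕ) (hNK : N = K)
    (Z : Fin K → Finset (Fin N))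
    (q : ℕ) (hq : IsPrimePow q) (E : ℕ) (hE : 0 < E)
    (F : Type) [Field F] [Fintype F] (hF : Fintype.card F = q)
    (Tk : Fin K → ℕ) (T : ℕ) (hTk : ∀ k, 0 < Tk k) (hT : 0 < T)
    (sch : DMTLScheme F K N E Z Tk T) (hc : sch.Correct) :
    (E : ℤ) * ((K : ℤ) * N - ∑ z ∈ Finset.Icc 1 K, (z : ℤ) *
        (Finset.univ.filter
          (fun n : Fin N => (Finset.univ.filter (fun k => n ∈ Z k)).card = z)).card)
      ≤ ((K : ℤ) - 1) * ∑ k, (Tk k : ℤ) := by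
  have hcount := sum_mul_card_filter_multiplicity_eq_sum_card Z
  rw [Fintype.card_fin] at hcount
  have hworker (k : Fin K) : (E : ℤ) * (N - (Z k).card) ≤ ∑ j, (Tk j : ℤ) - Tk k := by
    have h := hc.mul_card_compl_le k
    have hsplit := Finset.sum_erase_add Finset.univ Tk (Finset.mem_univ k)
    have hcompl := (Z k).card_add_card_compl
    rw [Fintype.card_fin] at hcompl
    zify at h hsplit hcompl
    rw [← hcompl, add_sub_cancel_left]
    linarith
  have hsum := Finset.sum_le_sum fun k (_ : k ∈ Finset.univ) => hworker k
  rw [← Finset.mul_sum] at hsum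
  simp only [Finset.sum_sub_distrib, Finset.sum_const, Finset.card_univ, Fintype.card_fin,
    nsmul_eq_mul] at hsum
  replace hcount := congrArg (Nat.cast : ℕ → ℤ) hcount
  simp only [Nat.cast_sum, Nat.cast_mul] at hcount
  rw [hcount]
  linarith
end

section
/- Let k ≥ 2 and S be positive integers, let d_1,…,d_k be positive integers, and let P_1,…,P_k be finite sets (subsets of some ambient set) with |P_i| = S − d_i for each i ∈ {1,…,k}. Assume that for every subset I ⊆ {1,…,k−1}, |P_k ∩ ⋂_{i∈I} P_i| ≤ S − d_k − Σ_{i∈I} d_i. Then there exist pairwise disjoint subsets Q_1,…,Q_{k−1} of P_k such that |Q_i| = d_i and Q_i ∩ P_i = ∅ for every i ∈ {1,…,k−1}. -/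
/-- Hall's marriage theorem with demands: if every set `I` of indices satisfies
`∑ i ∈ I, d i ≤ |⋃ i ∈ I, t i|`, then one can choose pairwise disjoint `Q i ⊆ t i` with
`|Q i| = d i`. -/
theorem exists_pairwise_disjoint_card_eq_of_sum_le_card_biUnion {ι α : Type*} [DecidableEq α]
    (t : ι → Finset α) (d : ι → ℕ) (h : ∀ I : Finset ι, ∑ i ∈ I, d i ≤ (I.biUnion t).card) :
    ∃ Q : ι → Finset α, (∀ i, Q i ⊆ t i) ∧ Pairwise (fun i j => Disjoint (Q i) (Q j)) ∧
      ∀ i, (Q i).card = d i := by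
  classical
  obtain ⟨f, hf, hft⟩ := (Finset.all_card_le_biUnion_card_iff_exists_injective
    (fun x : Σ i, Fin (d i) => t x.1)).1 fun s => by
      calc s.card ≤ ((s.image Sigma.fst).sigma fun i => (Finset.univ : Finset (Fin (d i)))).card :=
            Finset.card_le_card fun x hx =>
              Finset.mem_sigma.2 ⟨Finset.mem_image_of_mem _ hx, Finset.mem_univ _⟩
        _ = ∑ i ∈ s.image Sigma.fst, d i := by simp
        _ ≤ ((s.image Sigma.fst).biUnion t).card := h _
        _ = (s.biUnion fun x => t x.1).card := by rw [Finset.image_biUnion]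
  refine ⟨fun i => Finset.univ.image fun a : Fin (d i) => f ⟨i, a⟩, fun i => ?_,
    fun i j hij => ?_, fun i => ?_⟩
  · exact Finset.image_subset_iff.2 fun a _ => hft ⟨i, a⟩
  · refine Finset.disjoint_left.2 fun x hx hy => ?_
    obtain ⟨a, -, rfl⟩ := Finset.mem_image.1 hx
    obtain ⟨b, -, hb⟩ := Finset.mem_image.1 hy
    exact hij (congrArg Sigma.fst (hf hb)).symm
  · exact (Finset.card_image_of_injective _ (hf.comp sigma_mk_injective)).trans
      (Finset.card_fin (d i))

/-- Hall-type partition lemma.  With `P_1, …, P_{k−1}` and `P_k`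
(finite sets) of cardinalities `S − d_i` and `S − d_k`, if for every index set
`I ⊆ {1,…,k−1}` we have `|P_k ∩ ⋂_{i∈I} P_i| ≤ S − d_k − Σ_{i∈I} d_i`
(the empty `I` giving `|P_k| ≤ S − d_k`), then there are pairwise disjoint
subsets `Q_1, …, Q_{k−1}` of `P_k` with `|Q_i| = d_i` and `Q_i ∩ P_i = ∅`. -/
theorem hall_partition {α : Type*} [DecidableEq α] (k S : ℕ) (hk : 2 ≤ k) (hS : 1 ≤ S)
    (d : Fin (k - 1) → ℕ) (dk : ℕ) (hd : ∀ i, 1 ≤ d i) (hdk : 1 ≤ dk)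
    (P : Fin (k - 1) → Finset α) (Pk : Finset α)
    (hcard : ∀ i, ((P i).card : ℤ) = (S : ℤ) - d i)
    (hcardk : ((Pk).card : ℤ) = (S : ℤ) - dk)
    (hcap : ∀ I : Finset (Fin (k - 1)),
      (((Pk.filter (fun x => ∀ i ∈ I, x ∈ P i)).card : ℤ))
        ≤ (S : ℤ) - dk - ∑ i ∈ I, (d i : ℤ)) :
    ∃ Q : Fin (k - 1) → Finset α,
      (∀ i, Q i ⊆ Pk) ∧
      (∀ i j, i ≠ j → Disjoint (Q i) (Q j)) ∧
      (∀ i, (Q i).card = d i) ∧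
      (∀ i, Q i ∩ P i = ∅) := by
  obtain ⟨Q, hQ, hdisj, hQcard⟩ := exists_pairwise_disjoint_card_eq_of_sum_le_card_biUnion
    (fun i => Pk \ P i) d fun I => by
      have hunion : I.biUnion (fun i => Pk \ P i) = Pk.filter fun x => ¬ ∀ i ∈ I, x ∈ P i := by
        ext x
        simp only [Finset.mem_biUnion, Finset.mem_sdiff, Finset.mem_filter, not_forall]
        tauto
      have hsplit := Finset.card_filter_add_card_filter_not (s := Pk) fun x => ∀ i ∈ I, x ∈ P i
      have hI := hcap I
      rw [hunion]
      zify at hsplit ⊢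
      linarith
  refine ⟨Q, fun i => (hQ i).trans Finset.sdiff_subset, fun i j hij => hdisj hij, hQcard,
    fun i => ?_⟩
  exact Finset.disjoint_iff_inter_eq_empty.1 (Finset.disjoint_of_subset_left (hQ i)
    Finset.sdiff_disjoint)
end

section
/- Let F be a field and let M be an m×n matrix over F with the MDS property. Let s ⊆ {1,…,n} with |s| ≤ m. If x, y ∈ F^n satisfy M·x = M·y and x_j = y_j for every j ∉ s, then x = y. (In particular, given M·x and the entries of x outside s, the vector x is uniquely determined.) -/
/-- An `m × n` matrix over a field has the MDS property if every square submatrix,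
obtained by selecting any set of rows and any equally-sized set of columns, is invertible. -/
def IsMDS {F : Type*} [Field F] {m n : ℕ} (M : Matrix (Fin m) (Fin n) F) : Prop :=
  ∀ (k : ℕ) (s : Finset (Fin m)) (t : Finset (Fin n)) (hs : s.card = k) (ht : t.card = k),
    IsUnit (M.submatrix (s.orderEmbOfFin hs) (t.orderEmbOfFin ht)).det

/-- if `M` is MDS, `s ⊆ {1,…,n}` with `|s| ≤ m`, and `x, y` satisfy
`M·x = M·y` and agree outside `s`, then `x = y`. -/
theorem mds_unique_recovery {F : Type*} [Field F] {m n : ℕ}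
    (M : Matrix (Fin m) (Fin n) F) (hM : IsMDS M)
    (s : Finset (Fin n)) (hs : s.card ≤ m)
    (x y : Fin n → F) (hxy : M.mulVec x = M.mulVec y)
    (hout : ∀ j ∉ s, x j = y j) : x = y := by
  obtain ⟨r, -, hr⟩ := Finset.exists_subset_card_eq (s := (Finset.univ : Finset (Fin m)))
    (n := s.card) (by simpa using hs)
  have hdet := hM s.card r s hr rfl
  set e := s.orderEmbOfFin rfl
  have hz : M.mulVec (x - y) = 0 := by rw [Matrix.mulVec_sub, hxy, sub_self]
  have hsub : (M.submatrix (r.orderEmbOfFin hr) e).mulVec ((x - y) ∘ e) = 0 := by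
    funext i
    have hi : ∑ j, M (r.orderEmbOfFin hr i) j * (x - y) j = 0 :=
      congrFun hz (r.orderEmbOfFin hr i)
    rw [← Finset.sum_subset (Finset.subset_univ s)
      (fun j _ hj => by simp [hout j hj])] at hi
    have hsum := Finset.sum_map Finset.univ e.toEmbedding
      (fun j => M (r.orderEmbOfFin hr i) j * (x - y) j)
    rw [Finset.map_orderEmbOfFin_univ s rfl] at hsum
    exact hsum.symm.trans hi
  have hzero := Matrix.eq_zero_of_mulVec_eq_zero hdet.ne_zero hsub
  funext j
  by_cases hj : j ∈ s
  · have hmem : j ∈ Set.range e := by simpa [e] using hj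
    obtain ⟨i, rfl⟩ := hmem
    exact sub_eq_zero.mp (congrFun hzero i)
  · exact hout j hj
end

section
/- Let q be a prime power and let m, n be positive integers with m + n ≤ q. Then there exists an m×n matrix over the finite field F_q with the MDS property, i.e., a matrix every square submatrix of which is invertible. -/
open Polynomial in
/-- A square Cauchy matrix with pairwise distinct nodes is invertible. -/
theorem Matrix.det_cauchy_ne_zero {ι F : Type*} [Fintype ι] [DecidableEq ι] [Field F]
    {x y : ι → F} (hx : Function.Injective x) (hy : Function.Injective y)
    (hxy : ∀ i j, x i ≠ y j) : (Matrix.of fun i j => (x i - y j)⁻¹).det ≠ 0 := by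
  intro hdet
  obtain ⟨v, hv, hMv⟩ := Matrix.exists_mulVec_eq_zero_iff.mpr hdet
  let p : F[X] := ∑ j, C (v j) * ∏ l ∈ Finset.univ.erase j, (X - C (y l))
  have hp : p = 0 := by
    refine eq_zero_of_degree_lt_of_eval_index_eq_zero (s := Finset.univ) (v := x) hx.injOn ?_ ?_
    · refine (Polynomial.degree_sum_le _ _).trans_lt ?_
      rw [Finset.sup_lt_iff (WithBot.bot_lt_coe _)]
      intro j _
      rw [← smul_eq_C_mul]
      refine (degree_smul_le _ _).trans_lt ?_
      rw [degree_prod]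
      simp only [degree_X_sub_C, Finset.sum_const, nsmul_one]
      exact_mod_cast Finset.card_erase_lt_of_mem (Finset.mem_univ j)
    · intro i _
      have h := congrArg (· * ∏ l, (x i - y l)) (congrFun hMv i)
      simp only [Matrix.mulVec, dotProduct, Matrix.of_apply, Pi.zero_apply, zero_mul,
        Finset.sum_mul] at h
      rw [← h]
      simp only [p, eval_finsetSum, eval_mul, eval_C, eval_prod, eval_sub, eval_X]
      refine Finset.sum_congr rfl fun j _ => ?_
      rw [← Finset.mul_prod_erase _ _ (Finset.mem_univ j)]
      have := sub_ne_zero.mpr (hxy i j)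
      field_simp
  refine hv (funext fun j => ?_)
  have h := congrArg (eval (y j)) hp
  simp only [p, eval_finsetSum, eval_mul, eval_C, eval_prod, eval_sub, eval_X, eval_zero] at h
  rw [Finset.sum_eq_single j] at h
  · refine (mul_eq_zero.mp h).resolve_right (Finset.prod_ne_zero_iff.mpr fun l hl => ?_)
    exact sub_ne_zero.mpr fun e => Finset.ne_of_mem_erase hl (hy e).symm
  · intro i _ hij
    rw [Finset.prod_eq_zero (Finset.mem_erase.mpr ⟨hij.symm, Finset.mem_univ j⟩) (sub_self _),
      mul_zero]
  · simp

/-- for a prime power `q` and positive integers `m, n` with `m + n ≤ q`,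
there exists an `m × n` matrix over the field with `q` elements having the MDS property. -/
theorem exists_mds_matrix (q m n : ℕ) (hq : IsPrimePow q)
    (hm : 0 < m) (hn : 0 < n) (hmn : m + n ≤ q)
    (F : Type) [Field F] [Fintype F] (hF : Fintype.card F = q) :
    ∃ M : Matrix (Fin m) (Fin n) F, IsMDS M := by
  obtain ⟨f⟩ : Nonempty (Fin m ⊕ Fin n ↪ F) :=
    Function.Embedding.nonempty_of_card_le (by simpa [hF] using hmn)
  refine ⟨Matrix.of fun i j => (f (.inl i) - f (.inr j))⁻¹, fun k s t hs ht => ?_⟩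
  refine isUnit_iff_ne_zero.mpr (Matrix.det_cauchy_ne_zero
    (x := fun i => f (.inl (s.orderEmbOfFin hs i))) (y := fun j => f (.inr (t.orderEmbOfFin ht j)))
    ?_ ?_ ?_)
  · exact f.injective.comp (Sum.inl_injective.comp (s.orderEmbOfFin hs).injective)
  · exact f.injective.comp (Sum.inr_injective.comp (t.orderEmbOfFin ht).injective)
  · exact fun i j h => Sum.inl_ne_inr (f.injective h)
end
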